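/- Let 0 ≤ k ≤ i. The number of (i−k)-dimensional subspaces S̄ of 𝔽₂^i × 𝔽₂^i that are totally singular with respect to the quadratic form Q(a,b) = a·b equals [i choose k]₂ · Π_{j=k}^{i−1} (2^j + 1), where [i choose k]₂ = (2^i − 1)(2^{i−1} − 1)⋯(2^{i−k+1} − 1) / ((2^k − 1)(2^{k−1} − 1)⋯(2 − 1)) is the Gaussian binomial coefficient. -/

import Mathlib

open Matrix BigOperators

/-- `U i = 𝔽₂^i`. -/
abbrev U (i : ℕ) := Fin i → ZMod 2

/-- Standard inner product on `𝔽₂^i`. -/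
def dotp {i : ℕ} (a b : U i) : ZMod 2 := ∑ j, a j * b j

/-- The matrix of the map `X(a) : e_u ↦ e_{u+a}`. -/
def XM {i : ℕ} (a : U i) : Matrix (U i) (U i) ℝ :=
  fun w u => if w = u + a then 1 else 0

/-- The matrix of the map `Y(b) : e_u ↦ (−1)^{b·u} e_u`. -/
def YM {i : ℕ} (b : U i) : Matrix (U i) (U i) ℝ :=
  Matrix.diagonal (fun u => (-1 : ℝ) ^ (dotp b u).val)

/-- A subspace of `𝔽₂^i × 𝔽₂^i` is totally singular for `Q(a,b) = a·b` if
    `a·b = 0` for all its elements. -/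
def TotSing {i : ℕ} (S : Submodule (ZMod 2) (U i × U i)) : Prop :=
  ∀ p ∈ S, dotp p.1 p.2 = 0

/-- The nontrivial additive character `x ↦ (-1)^x` of `𝔽₂`. -/
def signChar : AddChar (ZMod 2) ℤ := AddChar.zmodChar 2 (ζ := -1) (by norm_num)

lemma one_add_signChar (x : ZMod 2) : 1 + signChar x = if x = 0 then 2 else 0 := by
  rw [signChar, AddChar.zmodChar_apply]
  revert x
  decide

lemma sum_signChar_comp {M : Type*} [AddCommGroup M] [Fintype M] (f : M →+ ZMod 2)
    [Decidable (f = 0)] :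
    ∑ x, signChar (f x) = if f = 0 then (Fintype.card M : ℤ) else 0 := by
  classical
  have h := AddChar.sum_eq_ite (signChar.compAddMonoidHom f)
  have hiff : signChar.compAddMonoidHom f = 0 ↔ f = 0 := by
    constructor
    · intro h0
      ext x
      have hx := DFunLike.congr_fun h0 x
      have h1 := one_add_signChar (f x)
      rw [AddChar.compAddMonoidHom_apply, AddChar.zero_apply] at hx
      rw [hx] at h1
      by_contra hne
      rw [if_neg (by simpa using hne)] at h1
      norm_num at h1
    · rintro rfl
      ext x
      simp
  simp only [AddChar.compAddMonoidHom_apply, hiff] at h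
  exact h

section

variable {i : ℕ}

/-- The bilinear form `((a, b), (c, d)) ↦ a·d + c·b` polarizing `(a, b) ↦ a·b`. -/
def polarHom (p : U i × U i) : U i × U i →+ ZMod 2 :=
  AddMonoidHom.mk' (fun s => dotp p.1 s.2 + dotp s.1 p.2) fun s t => by
    simp only [dotp, Prod.fst_add, Prod.snd_add, Pi.add_apply, mul_add, add_mul,
      Finset.sum_add_distrib]
    ring

lemma polarHom_apply (p s : U i × U i) : polarHom p s = dotp p.1 s.2 + dotp s.1 p.2 := rfl

lemma polarHom_comm (p s : U i × U i) : polarHom p s = polarHom s p := by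
  simp only [polarHom_apply, add_comm]

lemma dotp_add (p s : U i × U i) :
    dotp (p + s).1 (p + s).2 = dotp p.1 p.2 + dotp s.1 s.2 + polarHom p s := by
  simp only [polarHom_apply, dotp, Prod.fst_add, Prod.snd_add, Pi.add_apply, mul_add, add_mul,
    Finset.sum_add_distrib]
  ring

/-- The additive functional `b ↦ a·b`. -/
def dotpHom (a : U i) : U i →+ ZMod 2 :=
  AddMonoidHom.mk' (dotp a) fun s t => by
    simp only [dotp, Pi.add_apply, mul_add, Finset.sum_add_distrib]

lemma dotpHom_apply (a b : U i) : dotpHom a b = dotp a b := rfl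

lemma dotp_single (a : U i) (j : Fin i) : dotp a (Pi.single j 1) = a j := by
  simp [dotp, Pi.single_apply]

lemma single_dotp (a : U i) (j : Fin i) : dotp (Pi.single j 1) a = a j := by
  simp [dotp, Pi.single_apply]

lemma dotp_zero (a : U i) : dotp a 0 = 0 := by simp [dotp]

lemma zero_dotp (a : U i) : dotp 0 a = 0 := by simp [dotp]

lemma dotpHom_eq_zero {a : U i} : dotpHom a = 0 ↔ a = 0 := by
  constructor
  · intro h
    ext j
    rw [← dotp_single a j, ← dotpHom_apply, h]
    rfl
  · rintro rfl
    ext b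
    simp [dotpHom_apply, zero_dotp]

lemma polarHom_eq_zero {p : U i × U i} : polarHom p = 0 ↔ p = 0 := by
  constructor
  · intro h
    ext j
    · have := DFunLike.congr_fun h (0, Pi.single j 1)
      simpa [polarHom_apply, zero_dotp, dotp_single] using this
    · have := DFunLike.congr_fun h (Pi.single j 1, 0)
      simpa [polarHom_apply, dotp_zero, single_dotp] using this
  · rintro rfl
    ext b
    simp [polarHom_apply, zero_dotp, dotp_zero]

/-- The Gauss sum of the hyperbolic quadratic form `(a, b) ↦ a·b`. -/
lemma sum_signChar_dotp : ∑ v : U i × U i, signChar (dotp v.1 v.2) = 2 ^ i := by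
  classical
  rw [Fintype.sum_prod_type]
  simp_rw [← dotpHom_apply, sum_signChar_comp, dotpHom_eq_zero]
  simp [ZMod.card]

lemma sum_signChar_polarHom (s : U i × U i) :
    ∑ v, signChar (polarHom v s) = if s = 0 then (4 : ℤ) ^ i else 0 := by
  classical
  simp_rw [polarHom_comm _ s, sum_signChar_comp, polarHom_eq_zero]
  simp only [Fintype.card_prod, Fintype.card_fun, ZMod.card, Fintype.card_fin]
  push_cast
  rw [← mul_pow]
  norm_num

open Classical in
/-- A character-sum expression for the indicator of the vectors `v` such that
`v + S` consists of singular vectors. -/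
lemma indicator_eq_sum {S : Submodule (ZMod 2) (U i × U i)} (hS : TotSing S) (v : U i × U i) :
    2 * (Nat.card S : ℤ) * (if ∀ s ∈ S, dotp (v + s).1 (v + s).2 = 0 then 1 else 0) =
      ∑ s : S, (signChar (dotp (v + s).1 (v + s).2) + signChar (polarHom v s)) := by
  have hadd : ∀ s : S, dotp (v + s).1 (v + s).2 =
      dotp v.1 v.2 + (polarHom v).comp S.subtype.toAddMonoidHom s := by
    intro s
    rw [dotp_add, hS s s.2, add_zero]
    rfl
  have hsum := sum_signChar_comp ((polarHom v).comp S.subtype.toAddMonoidHom)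
  have hcond : (∀ s ∈ S, dotp (v + s).1 (v + s).2 = 0) ↔
      dotp v.1 v.2 = 0 ∧ (polarHom v).comp S.subtype.toAddMonoidHom = 0 := by
    constructor
    · intro h
      have h0 : dotp v.1 v.2 = 0 := by simpa using h 0 S.zero_mem
      refine ⟨h0, ?_⟩
      ext s
      have hs := h s s.2
      rwa [hadd, h0, zero_add] at hs
    · rintro ⟨h0, h1⟩ s hs
      have := hadd ⟨s, hs⟩
      rw [h0, h1] at this
      simpa using this
  have hterm : ∀ s : S, signChar (dotp (v + s).1 (v + s).2) + signChar (polarHom v s) =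
      (1 + signChar (dotp v.1 v.2)) *
        signChar ((polarHom v).comp S.subtype.toAddMonoidHom s) := by
    intro s
    rw [hadd, AddChar.map_add_eq_mul, add_mul, one_mul, add_comm]
    rfl
  rw [Finset.sum_congr rfl fun s _ => hterm s, ← Finset.mul_sum, hsum, one_add_signChar]
  simp only [hcond, Nat.card_eq_fintype_card]
  split_ifs <;> simp_all

/-- The number of vectors `v` for which `S + ⟨v⟩` is still totally singular. -/
lemma two_mul_card_mul_card_extend {S : Submodule (ZMod 2) (U i × U i)} (hS : TotSing S) :
    2 * Nat.card S * Nat.card {v : U i × U i // ∀ s ∈ S, dotp (v + s).1 (v + s).2 = 0} =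
      4 ^ i + Nat.card S * 2 ^ i := by
  classical
  have h := Finset.sum_congr (rfl : (Finset.univ : Finset (U i × U i)) = _)
    fun v _ => indicator_eq_sum hS v
  rw [← Finset.mul_sum, Finset.sum_boole, Finset.sum_comm] at h
  have hshift : ∀ s : S, ∑ v : U i × U i, signChar (dotp (v + s).1 (v + s).2) = 2 ^ i := by
    intro s
    rw [← sum_signChar_dotp]
    exact Fintype.sum_equiv (Equiv.addRight (s : U i × U i)) _ _ fun _ => rfl
  simp_rw [Finset.sum_add_distrib, hshift, sum_signChar_polarHom] at h
  rw [Nat.card_eq_fintype_card (α := {v // ∀ s ∈ S, dotp (v + s).1 (v + s).2 = 0}),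
    Fintype.card_subtype]
  simp only [ZeroMemClass.coe_eq_zero, Finset.sum_ite_eq', Finset.sum_const, Finset.mem_univ,
    if_true, Finset.card_univ, ← Nat.card_eq_fintype_card, nsmul_eq_mul] at h
  rw [add_comm]
  exact_mod_cast h

lemma totSing_span_cons {m : ℕ} (x : U i × U i) (s : Fin m → U i × U i) :
    TotSing (Submodule.span (ZMod 2) (Set.range (Fin.cons x s : Fin (m + 1) → U i × U i))) ↔
      TotSing (Submodule.span (ZMod 2) (Set.range s)) ∧
        ∀ t ∈ Submodule.span (ZMod 2) (Set.range s), dotp (x + t).1 (x + t).2 = 0 := by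
  simp only [TotSing, Fin.range_cons, Submodule.mem_span_insert]
  constructor
  · intro h
    exact ⟨fun p hp => h p ⟨0, p, hp, by simp⟩, fun t ht => h _ ⟨1, t, ht, by simp⟩⟩
  · rintro ⟨h₁, h₂⟩ _ ⟨a, t, ht, rfl⟩
    have ha : a = 0 ∨ a = 1 := by
      revert a
      decide
    obtain rfl | rfl := ha
    · simpa using h₁ t ht
    · simpa using h₂ t ht

/-- Bases of `m`-dimensional totally singular subspaces of `𝔽₂^i × 𝔽₂^i`. -/
abbrev SingularFrame (i m : ℕ) :=
  {s : Fin m → U i × U i // LinearIndependent (ZMod 2) s ∧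
    TotSing (Submodule.span (ZMod 2) (Set.range s))}

/-- A singular frame of length `m + 1` is a singular frame of length `m` with a compatible
vector outside its span. -/
def singularFrameSuccEquiv (i m : ℕ) :
    SingularFrame i (m + 1) ≃ Σ s : SingularFrame i m,
      {v : U i × U i // (∀ t ∈ Submodule.span (ZMod 2) (Set.range s.1),
        dotp (v + t).1 (v + t).2 = 0) ∧ v ∉ Submodule.span (ZMod 2) (Set.range s.1)} where
  toFun s :=
    have h : LinearIndependent (ZMod 2) (Fin.cons (s.1 0) (Fin.tail s.1) : Fin (m + 1) → _) ∧
        TotSing (Submodule.span (ZMod 2)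
          (Set.range (Fin.cons (s.1 0) (Fin.tail s.1) : Fin (m + 1) → U i × U i))) := by
      rw [Fin.cons_self_tail]
      exact s.2
    have h₁ := linearIndependent_finCons.1 h.1
    have h₂ := (totSing_span_cons _ _).1 h.2
    ⟨⟨Fin.tail s.1, h₁.1, h₂.1⟩, s.1 0, h₂.2, h₁.2⟩
  invFun p := ⟨Fin.cons p.2.1 p.1.1, linearIndependent_finCons.2 ⟨p.1.2.1, p.2.2.2⟩,
    (totSing_span_cons _ _).2 ⟨p.1.2.2, p.2.2.1⟩⟩
  left_inv s := Subtype.ext (Fin.cons_self_tail s.1)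
  right_inv p := rfl

lemma card_span_of_linearIndependent {m : ℕ} {s : Fin m → U i × U i}
    (hs : LinearIndependent (ZMod 2) s) :
    Nat.card (Submodule.span (ZMod 2) (Set.range s)) = 2 ^ m := by
  rw [Module.natCard_eq_pow_finrank (K := ZMod 2), finrank_span_eq_card hs]
  simp

lemma card_extend_singularFrame {m : ℕ} (hm : m < i) (s : SingularFrame i m) :
    (Nat.card {v : U i × U i // (∀ t ∈ Submodule.span (ZMod 2) (Set.range s.1),
        dotp (v + t).1 (v + t).2 = 0) ∧ v ∉ Submodule.span (ZMod 2) (Set.range s.1)} : ℚ) =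
      2 ^ m * ((2 ^ (i - m) - 1) * (2 ^ (i - 1 - m) + 1)) := by
  classical
  obtain ⟨s, hs, hsing⟩ := s
  set S := Submodule.span (ZMod 2) (Set.range s) with hS
  have hcard : Nat.card S = 2 ^ m := card_span_of_linearIndependent hs
  have htot := two_mul_card_mul_card_extend hsing
  have hsub : ∀ v ∈ S, ∀ t ∈ S, dotp (v + t).1 (v + t).2 = 0 :=
    fun v hv t ht => hsing _ (S.add_mem hv ht)
  have hsplit : Nat.card {v : U i × U i // ∀ t ∈ S, dotp (v + t).1 (v + t).2 = 0} =
      2 ^ m + Nat.card {v : U i × U i // (∀ t ∈ S, dotp (v + t).1 (v + t).2 = 0) ∧ v ∉ S} := by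
    rw [← hcard]
    simp only [Nat.card_eq_fintype_card, Fintype.card_subtype]
    rw [← Finset.card_filter_add_card_filter_not (fun v => v ∈ S), Finset.filter_filter,
      Finset.filter_filter]
    congr 2
    ext v
    simp only [Finset.mem_filter, Finset.mem_univ, true_and]
    exact and_iff_right_of_imp (hsub v)
  rw [hcard, hsplit] at htot
  obtain ⟨d, rfl⟩ := Nat.exists_eq_add_of_lt hm
  have hq := congrArg (Nat.cast : ℕ → ℚ) htot
  push_cast at hq
  have e₁ : m + d + 1 - m = d + 1 := by omega
  have e₂ : m + d + 1 - 1 - m = d := by omega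
  have e₃ : (4 : ℚ) = 2 ^ 2 := by norm_num
  rw [e₁, e₂]
  rw [e₃, ← pow_mul] at hq
  have h2 : (2 * 2 ^ m : ℚ) ≠ 0 := by positivity
  apply mul_left_cancel₀ h2
  linear_combination hq

lemma card_singularFrame {m : ℕ} (hm : m ≤ i) :
    (Nat.card (SingularFrame i m) : ℚ) =
      ∏ r ∈ Finset.range m, (2 ^ r * ((2 ^ (i - r) - 1) * (2 ^ (i - 1 - r) + 1))) := by
  classical
  induction m with
  | zero =>
    have : Unique (SingularFrame i 0) :=
      { default := ⟨Fin.elim0, linearIndependent_empty_type, by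
          simp [TotSing, Set.range_eq_empty, dotp]⟩
        uniq := fun s => Subtype.ext (Subsingleton.elim _ _) }
    simp
  | succ m ih =>
    rw [Nat.card_congr (singularFrameSuccEquiv i m), Nat.card_sigma]
    push_cast
    rw [Finset.sum_congr rfl fun s _ => card_extend_singularFrame hm s, Finset.sum_const,
      Finset.card_univ, ← Nat.card_eq_fintype_card, nsmul_eq_mul, ih (Nat.le_of_succ_le hm),
      Finset.prod_range_succ]

lemma span_range_subtype_comp {m : ℕ} {S : Submodule (ZMod 2) (U i × U i)}
    (hS : Module.finrank (ZMod 2) S = m) {s : Fin m → S} (hs : LinearIndependent (ZMod 2) s) :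
    Submodule.span (ZMod 2) (Set.range fun j => (s j : U i × U i)) = S := by
  have htop : Submodule.span (ZMod 2) (Set.range s) = ⊤ :=
    hs.span_eq_top_of_card_eq_finrank' (by simp [hS])
  have := congrArg (Submodule.map S.subtype) htop
  rw [Submodule.map_span, Submodule.map_top, Submodule.range_subtype, ← Set.range_comp] at this
  exact this

/-- A singular frame amounts to a totally singular subspace together with one of its bases. -/
noncomputable def singularFrameEquiv (i m : ℕ) :
    (Σ S : {S : Submodule (ZMod 2) (U i × U i) // Module.finrank (ZMod 2) S = m ∧ TotSing S},
      {s : Fin m → S.1 // LinearIndependent (ZMod 2) s}) ≃ SingularFrame i m :=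
  Equiv.ofBijective
    (fun p => ⟨fun j => (p.2.1 j : U i × U i), by
      refine ⟨p.2.2.map' p.1.1.subtype p.1.1.ker_subtype, ?_⟩
      rw [span_range_subtype_comp p.1.2.1 p.2.2]
      exact p.1.2.2⟩) <| by
    constructor
    · rintro ⟨⟨S, hS, hS'⟩, s, hs⟩ ⟨⟨T, hT, hT'⟩, t, ht⟩ h
      have hst : (fun j => (s j : U i × U i)) = fun j => (t j : U i × U i) :=
        congrArg Subtype.val h
      obtain rfl : S = T := by
        rw [← span_range_subtype_comp hS hs, hst, span_range_subtype_comp hT ht]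
      obtain rfl : s = t := funext fun j => Subtype.ext (congrFun hst j)
      rfl
    · rintro ⟨s, hs, hsing⟩
      exact ⟨⟨⟨Submodule.span (ZMod 2) (Set.range s), by simp [finrank_span_eq_card hs], hsing⟩,
        fun j => ⟨s j, Submodule.subset_span ⟨j, rfl⟩⟩, linearIndependent_span hs⟩, rfl⟩

lemma card_totSing_mul (i m : ℕ) :
    (Nat.card {S : Submodule (ZMod 2) (U i × U i) //
        Module.finrank (ZMod 2) S = m ∧ TotSing S} : ℚ) *
      ∏ r ∈ Finset.range m, (2 ^ r * (2 ^ (m - r) - 1)) = Nat.card (SingularFrame i m) := by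
  classical
  have hbases : ∀ S : {S : Submodule (ZMod 2) (U i × U i) //
      Module.finrank (ZMod 2) S = m ∧ TotSing S},
      (Nat.card {s : Fin m → S.1 // LinearIndependent (ZMod 2) s} : ℚ) =
        ∏ r ∈ Finset.range m, (2 ^ r * (2 ^ (m - r) - 1)) := by
    intro S
    rw [card_linearIndependent S.2.1.ge, S.2.1, ZMod.card, Nat.cast_prod,
      Fin.prod_univ_eq_prod_range (fun r => ((2 ^ m - 2 ^ r : ℕ) : ℚ))]
    refine Finset.prod_congr rfl fun r hr => ?_
    have hr' : r ≤ m := (Finset.mem_range.1 hr).le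
    rw [Nat.cast_sub (Nat.pow_le_pow_right two_pos hr'), mul_sub, ← pow_add,
      Nat.add_sub_cancel' hr']
    push_cast
    ring
  rw [← Nat.card_congr (singularFrameEquiv i m), Nat.card_sigma]
  push_cast
  rw [Finset.sum_congr rfl fun S _ => hbases S, Finset.sum_const, Finset.card_univ,
    ← Nat.card_eq_fintype_card, nsmul_eq_mul]

lemma prod_two_pow_sub_one_ne_zero (n : ℕ) :
    ∏ j ∈ Finset.range n, ((2 : ℚ) ^ (n - j) - 1) ≠ 0 := by
  refine Finset.prod_ne_zero_iff.2 fun j hj => ?_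
  have hj' : n - j ≠ 0 := (Nat.sub_pos_of_lt (Finset.mem_range.1 hj)).ne'
  exact sub_ne_zero.2 (one_lt_pow₀ one_lt_two hj').ne'

lemma prod_two_pow_sub_one_split {k : ℕ} (hk : k ≤ i) :
    (∏ j ∈ Finset.range k, ((2 : ℚ) ^ (i - j) - 1)) *
        ∏ j ∈ Finset.range (i - k), ((2 : ℚ) ^ (i - k - j) - 1) =
      ∏ j ∈ Finset.range i, ((2 : ℚ) ^ (i - j) - 1) := by
  conv_rhs => rw [← Nat.add_sub_cancel' hk, Finset.prod_range_add]
  rw [Nat.add_sub_cancel' hk]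
  simp only [Nat.sub_sub]

lemma prod_Ico_two_pow_add_one {k : ℕ} (hk : k ≤ i) :
    ∏ j ∈ Finset.range (i - k), ((2 : ℚ) ^ (i - 1 - j) + 1) =
      ∏ j ∈ Finset.Ico k i, ((2 : ℚ) ^ j + 1) := by
  rw [Finset.prod_Ico_eq_prod_range, ← Finset.prod_range_reflect]
  refine Finset.prod_congr rfl fun j hj => ?_
  have := Finset.mem_range.1 hj
  congr 2
  omega

end

/-- the number of totally singular `(i−k)`-dimensional subspaces of
    `𝔽₂^i × 𝔽₂^i` equals `[i choose k]₂ · Π_{j=k}^{i-1} (2^j + 1)`. -/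
theorem stmt9 (i k : ℕ) (hk : k ≤ i) :
    (Nat.card {S : Submodule (ZMod 2) (U i × U i) //
        Module.finrank (ZMod 2) S = i - k ∧ TotSing S} : ℚ) =
      ((∏ j ∈ Finset.range k, ((2 : ℚ) ^ (i - j) - 1)) /
        (∏ j ∈ Finset.range k, ((2 : ℚ) ^ (k - j) - 1))) *
      (∏ j ∈ Finset.Ico k i, ((2 : ℚ) ^ j + 1)) := by
  have hcount := card_totSing_mul i (i - k)
  rw [card_singularFrame (Nat.sub_le i k)] at hcount
  simp only [Finset.prod_mul_distrib] at hcount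
  rw [prod_Ico_two_pow_add_one hk] at hcount
  have hsplit := prod_two_pow_sub_one_split hk
  have hsplit' := prod_two_pow_sub_one_split (Nat.sub_le i k)
  rw [Nat.sub_sub_self hk, ← hsplit] at hsplit'
  have hpow : ∏ r ∈ Finset.range (i - k), (2 : ℚ) ^ r ≠ 0 :=
    Finset.prod_ne_zero_iff.2 fun r _ => pow_ne_zero r two_ne_zero
  have hB := prod_two_pow_sub_one_ne_zero k
  have hD := prod_two_pow_sub_one_ne_zero (i - k)
  rw [div_mul_eq_mul_div, eq_div_iff hB]
  apply mul_left_cancel₀ (mul_ne_zero hpow hD)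
  linear_combination (∏ j ∈ Finset.range k, ((2 : ℚ) ^ (k - j) - 1)) * hcount +
    (∏ r ∈ Finset.range (i - k), (2 : ℚ) ^ r) * (∏ j ∈ Finset.Ico k i, ((2 : ℚ) ^ j + 1)) * hsplit'
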